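/- Let M=(Q,Σ,μ,F) be a dwta over the commutative semifield S and let ≅ be a congruence of M that respects F. Then there exists a map sol assigning to every ≅-class B consisting of live states a context sol(B)∈C_Σ(Q) that is a sign of life for every state in B, and such that sol(B) = □ whenever B ⊆ F. -/

import Mathlib

open scoped BigOperators Classical

namespace WTA

/-- Trees over a ranked alphabet `Sig` (with arity map `ar`), indexed by states `Q`. -/
inductive PTree (Sig : Type) (ar : Sig → ℕ) (Q : Type) : Type where
  | state : Q → PTree Sig ar Q
  | node : (s : Sig) → (Fin (ar s) → PTree Sig ar Q) → PTree Sig ar Q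

/-- Contexts: trees with exactly one occurrence of the hole `□` at a leaf. -/
inductive Ctx (Sig : Type) (ar : Sig → ℕ) (Q : Type) : Type where
  | hole : Ctx Sig ar Q
  | node : (s : Sig) → (i : Fin (ar s)) → (Fin (ar s) → PTree Sig ar Q) →
      Ctx Sig ar Q → Ctx Sig ar Q

variable {Sig Q Q' S : Type} {ar : Sig → ℕ}

/-- Substitution `c[t]` of a tree into the hole of a context. -/
def Ctx.subst : Ctx Sig ar Q → PTree Sig ar Q → PTree Sig ar Q
  | .hole, t => t
  | .node s i ts c, t => .node s (Function.update ts i (c.subst t))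

/-- A closed tree (over `T_Σ`) viewed as a tree indexed by `Q`. -/
def PTree.ofClosed : PTree Sig ar Empty → PTree Sig ar Q
  | .state e => e.elim
  | .node s ts => .node s fun i => (ts i).ofClosed

/-- A closed context viewed as a context with states in `Q`. -/
def Ctx.ofClosed : Ctx Sig ar Empty → Ctx Sig ar Q
  | .hole => .hole
  | .node s i ts c => .node s i (fun j => (ts j).ofClosed) c.ofClosed

/-- Renaming of the states occurring in a tree. -/
def PTree.rename (g : Q → Q') : PTree Sig ar Q → PTree Sig ar Q'
  | .state p => .state (g p)
  | .node s ts => .node s fun i => (ts i).rename g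

/-- Renaming of the states occurring in a context. -/
def Ctx.rename (g : Q → Q') : Ctx Sig ar Q → Ctx Sig ar Q'
  | .hole => .hole
  | .node s i ts c => .node s i (fun j => (ts j).rename g) (c.rename g)

/-- The extension `h_μ` of the transition weight assignment `μ` to trees:
`h_μ(t → q)`. -/
noncomputable def hmu [Fintype Q] [CommSemiring S]
    (μ : ∀ s : Sig, (Fin (ar s) → Q) → Q → S) : PTree Sig ar Q → Q → S
  | .state p, q => if p = q then 1 else 0
  | .node s ts, q => ∑ qs : Fin (ar s) → Q, μ s qs q * ∏ i, hmu μ (ts i) (qs i)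

/-- The weighted tree language recognized by the wta `(Q, Σ, μ, F)`:
`M(t) = Σ_{q ∈ F} h_μ(t → q)`. -/
noncomputable def wtaSem [Fintype Q] [CommSemiring S]
    (μ : ∀ s : Sig, (Fin (ar s) → Q) → Q → S) (F : Finset Q)
    (t : PTree Sig ar Empty) : S :=
  ∑ q ∈ F, hmu μ (PTree.ofClosed t) q

/-- Bottom-up determinism: every left-hand side `σ(q₁,…,q_k)` has at most one
target state with nonzero weight. -/
def Deterministic [CommSemiring S] (μ : ∀ s : Sig, (Fin (ar s) → Q) → Q → S) : Prop :=
  ∀ (s : Sig) (qs : Fin (ar s) → Q) (q q' : Q), μ s qs q ≠ 0 → μ s qs q' ≠ 0 → q = q'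

/-- The pushed transition weight assignment
`μ'(σ(q₁,…,q_k) → q) = λ(q) · μ(σ(q₁,…,q_k) → q) · ∏ᵢ λ(qᵢ)⁻¹`. -/
noncomputable def push [Fintype Q] [Semifield S] (lam : Q → S)
    (μ : ∀ s : Sig, (Fin (ar s) → Q) → Q → S) :
    ∀ s : Sig, (Fin (ar s) → Q) → Q → S :=
  fun s qs q => lam q * μ s qs q * ∏ i, (lam (qs i))⁻¹

/-- `h_μ^{(1)}(t) ∈ F` (for a deterministic wta): some final state is reached
with nonzero weight. -/
def finReach [Fintype Q] [CommSemiring S]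
    (μ : ∀ s : Sig, (Fin (ar s) → Q) → Q → S) (F : Finset Q)
    (t : PTree Sig ar Q) : Prop :=
  ∃ q ∈ F, hmu μ t q ≠ 0

/-- `h_μ^{(2)}(t) · χ_F(h_μ^{(1)}(t))` (for a deterministic wta); an undefined
value counts as `0`. -/
noncomputable def cweight [Fintype Q] [CommSemiring S]
    (μ : ∀ s : Sig, (Fin (ar s) → Q) → Q → S) (F : Finset Q)
    (t : PTree Sig ar Q) : S :=
  ∑ q ∈ F, hmu μ t q

/-- `h_μ^{(2)}(t)` (for a deterministic wta); an undefined value counts as `0`. -/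
noncomputable def tweight [Fintype Q] [CommSemiring S]
    (μ : ∀ s : Sig, (Fin (ar s) → Q) → Q → S) (t : PTree Sig ar Q) : S :=
  ∑ q, hmu μ t q

/-- A context `c` is a sign of life for the state `q` if `h_μ^{(1)}(c[q]) ∈ F`. -/
def SignOfLife [Fintype Q] [CommSemiring S]
    (μ : ∀ s : Sig, (Fin (ar s) → Q) → Q → S) (F : Finset Q)
    (c : Ctx Sig ar Q) (q : Q) : Prop :=
  finReach μ F (c.subst (.state q))

/-- A state is live if it has a sign of life. -/
def Live [Fintype Q] [CommSemiring S]
    (μ : ∀ s : Sig, (Fin (ar s) → Q) → Q → S) (F : Finset Q) (q : Q) : Prop :=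
  ∃ c : Ctx Sig ar Q, SignOfLife μ F c q

/-- Weak equivalence `q₁ ∼_M q₂`. -/
def WeakEquiv [Fintype Q] [CommSemiring S]
    (μ : ∀ s : Sig, (Fin (ar s) → Q) → Q → S) (F : Finset Q)
    (q₁ q₂ : Q) : Prop :=
  ∀ c : Ctx Sig ar Q,
    finReach μ F (c.subst (.state q₁)) ↔ finReach μ F (c.subst (.state q₂))

/-- Myhill–Nerode equivalence `q₁ ≡_M q₂`: there is a nonzero factor `s` with
`h_μ^{(2)}(c[q₁])·χ_F(h_μ^{(1)}(c[q₁])) = s · h_μ^{(2)}(c[q₂])·χ_F(h_μ^{(1)}(c[q₂]))`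
for all contexts `c`. -/
def MNEquiv [Fintype Q] [CommSemiring S]
    (μ : ∀ s : Sig, (Fin (ar s) → Q) → Q → S) (F : Finset Q)
    (q₁ q₂ : Q) : Prop :=
  ∃ s : S, s ≠ 0 ∧ ∀ c : Ctx Sig ar Q,
    cweight μ F (c.subst (.state q₁)) = s * cweight μ F (c.subst (.state q₂))

/-- `r` is a congruence of the dwta: equivalent left-hand sides have equivalent
targets (`μ^{(1)}`-values), where two undefined values are regarded as
equivalent and an undefined value is never equivalent to a defined one. -/
def IsCongruence [Fintype Q] [CommSemiring S]
    (μ : ∀ s : Sig, (Fin (ar s) → Q) → Q → S) (r : Q → Q → Prop) : Prop :=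
  ∀ (s : Sig) (qs qs' : Fin (ar s) → Q), (∀ i, r (qs i) (qs' i)) →
    ((∃ q, μ s qs q ≠ 0) ↔ (∃ q, μ s qs' q ≠ 0)) ∧
    (∀ q q', μ s qs q ≠ 0 → μ s qs' q' ≠ 0 → r q q')

/-- `r` respects `F`: every class lies inside `F` or outside `F`. -/
def Respects (r : Q → Q → Prop) (F : Finset Q) : Prop :=
  ∀ q q', r q q' → (q ∈ F ↔ q' ∈ F)

/-- Accessibility: every state is reached by some (closed) tree. -/
def Accessible [Fintype Q] [CommSemiring S]
    (μ : ∀ s : Sig, (Fin (ar s) → Q) → Q → S) : Prop :=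
  ∀ q : Q, ∃ t : PTree Sig ar Empty, hmu μ (PTree.ofClosed t) q ≠ 0

/-- The transition weight assignment of the alphabetic dwta `syn(N)` over the
ranked alphabet `Σ × S` (where `⟨σ, s⟩` has the rank of `σ`):
`ν''(⟨σ,s⟩(q₁,…,q_k) → q) = 1` iff `ν(σ(q₁,…,q_k) → q) = s ≠ 0`. -/
noncomputable def synMu [Fintype Q] [CommSemiring S]
    (ν : ∀ s : Sig, (Fin (ar s) → Q) → Q → S) :
    ∀ p : Sig × S, (Fin ((fun p : Sig × S => ar p.1) p) → Q) → Q → S :=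
  fun p qs q => if ν p.1 qs q = p.2 ∧ p.2 ≠ 0 then 1 else 0

/-- Runs of the unweighted tree automaton `unw(M)` with transitions `supp(μ)`:
`Reach μ t q` iff `unw(M)` can reach state `q` on the tree `t`. -/
inductive Reach [CommSemiring S] (μ : ∀ s : Sig, (Fin (ar s) → Q) → Q → S) :
    PTree Sig ar Q → Q → Prop where
  | state (q : Q) : Reach μ (.state q) q
  | node {s : Sig} (ts : Fin (ar s) → PTree Sig ar Q) (qs : Fin (ar s) → Q) (q : Q)
      (h : μ s qs q ≠ 0) (hc : ∀ i, Reach μ (ts i) (qs i)) : Reach μ (.node s ts) q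

theorem exists_of_hmu_node_ne_zero [Fintype Q] [Semifield S]
    {μ : ∀ s : Sig, (Fin (ar s) → Q) → Q → S} {s : Sig}
    {ts : Fin (ar s) → PTree Sig ar Q} {q : Q} (h : hmu μ (.node s ts) q ≠ 0) :
    ∃ qs : Fin (ar s) → Q, μ s qs q ≠ 0 ∧ ∀ i, hmu μ (ts i) (qs i) ≠ 0 := by
  rw [hmu] at h
  obtain ⟨qs, -, hqs⟩ := Finset.exists_ne_zero_of_sum_ne_zero h
  exact ⟨qs, left_ne_zero_of_mul hqs,
    fun i => Finset.prod_ne_zero_iff.mp (right_ne_zero_of_mul hqs) i (Finset.mem_univ i)⟩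

/-- A deterministic wta reaches at most one state on each tree. -/
theorem Deterministic.hmu_unique [Fintype Q] [Semifield S]
    {μ : ∀ s : Sig, (Fin (ar s) → Q) → Q → S} (hdet : Deterministic μ)
    (t : PTree Sig ar Q) {q q' : Q} (h : hmu μ t q ≠ 0) (h' : hmu μ t q' ≠ 0) : q = q' := by
  induction t generalizing q q' with
  | state p =>
    simp only [hmu, ne_eq, ite_eq_right_iff, one_ne_zero, imp_false, not_not] at h h'
    exact h.symm.trans h'
  | node s ts ih =>
    obtain ⟨qs, hq, hqs⟩ := exists_of_hmu_node_ne_zero h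
    obtain ⟨qs', hq', hqs'⟩ := exists_of_hmu_node_ne_zero h'
    obtain rfl : qs = qs' := funext fun i => ih i (hqs i) (hqs' i)
    exact hdet s qs q q' hq hq'

theorem Deterministic.hmu_node_ne_zero [Fintype Q] [Semifield S]
    {μ : ∀ s : Sig, (Fin (ar s) → Q) → Q → S} (hdet : Deterministic μ) {s : Sig}
    {ts : Fin (ar s) → PTree Sig ar Q} {qs : Fin (ar s) → Q} {q : Q}
    (hq : μ s qs q ≠ 0) (hqs : ∀ i, hmu μ (ts i) (qs i) ≠ 0) :
    hmu μ (.node s ts) q ≠ 0 := by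
  rw [hmu, Finset.sum_eq_single qs]
  · exact mul_ne_zero hq (Finset.prod_ne_zero_iff.mpr fun i _ => hqs i)
  · intro qs' _ hne
    by_contra h
    refine hne (funext fun i => hdet.hmu_unique (ts i) ?_ (hqs i))
    exact Finset.prod_ne_zero_iff.mp (right_ne_zero_of_mul h) i (Finset.mem_univ i)
  · exact fun h => absurd (Finset.mem_univ qs) h

/-- Congruent states plugged into the same context reach congruent states. -/
theorem IsCongruence.exists_hmu_subst_ne_zero [Fintype Q] [Semifield S]
    {μ : ∀ s : Sig, (Fin (ar s) → Q) → Q → S} (hdet : Deterministic μ)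
    {r : Q → Q → Prop} (hrefl : ∀ q, r q q) (hcong : IsCongruence μ r)
    {p p' : Q} (hp : r p p') (c : Ctx Sig ar Q) {q : Q}
    (h : hmu μ (c.subst (.state p)) q ≠ 0) :
    ∃ q', r q q' ∧ hmu μ (c.subst (.state p')) q' ≠ 0 := by
  induction c generalizing q with
  | hole =>
    simp only [Ctx.subst, hmu, ne_eq, ite_eq_right_iff, one_ne_zero, imp_false, not_not] at h
    subst h
    exact ⟨p', hp, by simp [Ctx.subst, hmu]⟩
  | node s i ts c ih =>
    simp only [Ctx.subst] at h ⊢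
    obtain ⟨qs, hq, hqs⟩ := exists_of_hmu_node_ne_zero h
    obtain ⟨a, hra, ha⟩ := ih (q := qs i) (by simpa using hqs i)
    have hrel : ∀ j, r (qs j) (Function.update qs i a j) := by
      intro j
      rcases eq_or_ne j i with rfl | hj
      · simpa using hra
      · simpa [hj] using hrefl (qs j)
    obtain ⟨hdef, htarget⟩ := hcong s qs _ hrel
    obtain ⟨q', hq'⟩ := hdef.mp ⟨q, hq⟩
    refine ⟨q', htarget q q' hq hq', hdet.hmu_node_ne_zero hq' fun j => ?_⟩
    rcases eq_or_ne j i with rfl | hj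
    · simpa using ha
    · simpa [hj] using hqs j

theorem SignOfLife.of_congruent [Fintype Q] [Semifield S]
    {μ : ∀ s : Sig, (Fin (ar s) → Q) → Q → S} {F : Finset Q} (hdet : Deterministic μ)
    {r : Q → Q → Prop} (hrefl : ∀ q, r q q) (hcong : IsCongruence μ r)
    (hresp : Respects r F) {p p' : Q} (hp : r p p') {c : Ctx Sig ar Q}
    (h : SignOfLife μ F c p) : SignOfLife μ F c p' := by
  obtain ⟨q, hqF, hq⟩ := h
  obtain ⟨q', hr, hreach⟩ := hcong.exists_hmu_subst_ne_zero hdet hrefl hp c hq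
  exact ⟨q', (hresp q q' hr).mp hqF, hreach⟩

/-- A live state has a sign of life that is trivial if the state is final. -/
theorem exists_signOfLife_hole_of_mem [Fintype Q] [Semifield S]
    (μ : ∀ s : Sig, (Fin (ar s) → Q) → Q → S) (F : Finset Q) (q : Q) :
    ∃ c : Ctx Sig ar Q, Live μ F q → SignOfLife μ F c q ∧ (q ∈ F → c = Ctx.hole) := by
  by_cases hF : q ∈ F
  · exact ⟨Ctx.hole, fun _ => ⟨⟨q, hF, by simp [Ctx.subst, hmu]⟩, fun _ => rfl⟩⟩
  · by_cases hL : Live μ F q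
    · exact ⟨hL.choose, fun _ => ⟨hL.choose_spec, fun h => absurd h hF⟩⟩
    · exact ⟨Ctx.hole, fun h => absurd h hL⟩

/-- There is a map `sol` assigning to every `≅`-class of live
states a common sign of life, which is the trivial context `□` on classes of
final states.  (The map is represented on states, constant on `≅`-classes.) -/
theorem exists_sol {Sig Q S : Type} {ar : Sig → ℕ}
    [Fintype Q] [Semifield S]
    (μ : ∀ s : Sig, (Fin (ar s) → Q) → Q → S) (F : Finset Q)
    (hdet : Deterministic μ)
    (r : Q → Q → Prop) (hequiv : Equivalence r)
    (hcong : IsCongruence μ r) (hresp : Respects r F) :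
    ∃ sol : Q → Ctx Sig ar Q, ∀ q : Q, Live μ F q →
      SignOfLife μ F (sol q) q ∧ (q ∈ F → sol q = Ctx.hole) ∧
      (∀ q' : Q, r q q' → sol q' = sol q) := by
  let R : Setoid Q := ⟨r, hequiv⟩
  let rep : Q → Q := fun q => (Quotient.mk R q).out
  have hrep : ∀ q, r (rep q) q := fun q => Quotient.mk_out (s := R) q
  choose f hf using exists_signOfLife_hole_of_mem μ F
  refine ⟨fun q => f (rep q), fun q hq => ?_⟩
  obtain ⟨c, hc⟩ := hq
  obtain ⟨hsign, hhole⟩ := hf (rep q)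
    ⟨c, hc.of_congruent hdet hequiv.refl hcong hresp (hequiv.symm (hrep q))⟩
  refine ⟨hsign.of_congruent hdet hequiv.refl hcong hresp (hrep q),
    fun hF => hhole ((hresp _ _ (hrep q)).mpr hF), fun q' hqq' => ?_⟩
  have : Quotient.mk R q' = Quotient.mk R q := Quotient.sound (hequiv.symm hqq')
  simp only [rep, this]

end WTA
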